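/- Let K ⊂ ℝ^N be a convex body and let r*_K > 0 be the radius determined by |B(x, r*_K)| = |K|. Then the Fraenkel asymmetry A(K) = min_{x ∈ ℝ^N} |K Δ B(x, r*_K)| / |K| is attained by at least one ball whose center belongs to the heart ♥(K); that is, there exists x₀ ∈ ♥(K) with |K Δ B(x₀, r*_K)| / |K| = A(K). -/

import Mathlib

open MeasureTheory Set Metric
open scoped RealInnerProductSpace ENNReal NNReal

noncomputable section

/-- Reflection of `x` across the hyperplane `{z : ⟪z, ω⟫ = l}` (for a unit vector `ω`). -/
def reflectH {N : ℕ} (l : ℝ) (ω x : EuclideanSpace ℝ (Fin N)) : EuclideanSpace ℝ (Fin N) :=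
  x + (2 * (l - ⟪x, ω⟫)) • ω

/-- The maximal folding function of a set `K`:
`R_K(ω) = inf {l : the reflection of K ∩ {⟪·,ω⟫ ≥ l} across {⟪·,ω⟫ = l} lies in K}`. -/
def foldingFn {N : ℕ} (K : Set (EuclideanSpace ℝ (Fin N))) (ω : EuclideanSpace ℝ (Fin N)) : ℝ :=
  sInf {l : ℝ | reflectH l ω '' {x ∈ K | l ≤ ⟪x, ω⟫} ⊆ K}

/-- The heart of a set `K`. -/
def heart {N : ℕ} (K : Set (EuclideanSpace ℝ (Fin N))) : Set (EuclideanSpace ℝ (Fin N)) :=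
  {x ∈ K | ∀ ω : EuclideanSpace ℝ (Fin N), ‖ω‖ = 1 → ⟪x, ω⟫ ≤ foldingFn K ω}

/-- Squared distance from a reflected point. -/
lemma dist_reflectH_sq {N : ℕ} {l : ℝ} {ω : EuclideanSpace ℝ (Fin N)} (hω : ‖ω‖ = 1)
    (y z : EuclideanSpace ℝ (Fin N)) :
    dist (reflectH l ω y) z ^ 2 = dist y z ^ 2 + 4 * (l - ⟪y, ω⟫) * (l - ⟪z, ω⟫) := by
  have h : reflectH l ω y - z = (y - z) + (2 * (l - ⟪y, ω⟫)) • ω := by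
    rw [reflectH]; abel
  rw [dist_eq_norm, dist_eq_norm, h, norm_add_sq_real, inner_smul_right, inner_sub_left,
    norm_smul, hω, mul_one, Real.norm_eq_abs, sq_abs]
  ring

lemma inner_reflectH {N : ℕ} {l : ℝ} {ω : EuclideanSpace ℝ (Fin N)} (hω : ‖ω‖ = 1)
    (y : EuclideanSpace ℝ (Fin N)) : ⟪reflectH l ω y, ω⟫ = 2 * l - ⟪y, ω⟫ := by
  rw [reflectH, inner_add_left, inner_smul_left, real_inner_self_eq_norm_sq, hω]
  simp
  ring

lemma reflectH_reflectH {N : ℕ} {l : ℝ} {ω : EuclideanSpace ℝ (Fin N)} (hω : ‖ω‖ = 1)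
    (y : EuclideanSpace ℝ (Fin N)) : reflectH l ω (reflectH l ω y) = y := by
  rw [reflectH, inner_reflectH hω, reflectH, add_assoc, ← add_smul]
  ring_nf
  simp

lemma dist_reflectH_reflectH {N : ℕ} {l : ℝ} {ω : EuclideanSpace ℝ (Fin N)} (hω : ‖ω‖ = 1)
    (y z : EuclideanSpace ℝ (Fin N)) : dist (reflectH l ω y) (reflectH l ω z) = dist y z := by
  rw [← sq_eq_sq₀ dist_nonneg dist_nonneg, dist_reflectH_sq hω, dist_comm y, dist_reflectH_sq hω,
    inner_reflectH hω, dist_comm z]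
  ring

lemma measurePreserving_reflectH {N : ℕ} {l : ℝ} {ω : EuclideanSpace ℝ (Fin N)} (hω : ‖ω‖ = 1) :
    MeasurePreserving (reflectH l ω) volume volume := by
  have h : reflectH l ω = (fun x => x + (2 * l) • ω) ∘ (ℝ ∙ ω)ᗮ.reflection := by
    ext1 x
    rw [Function.comp_apply, Submodule.reflection_orthogonal_apply,
      Submodule.reflection_singleton_apply, hω, real_inner_comm, reflectH]
    module
  rw [h]
  exact (measurePreserving_add_right volume _).comp (LinearIsometryEquiv.measurePreserving _)

/-- For a convex set, the admissible folding levels are upward closed. -/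
lemma image_reflectH_subset_of_le {N : ℕ} {K : Set (EuclideanSpace ℝ (Fin N))}
    (hK : Convex ℝ K) {ω : EuclideanSpace ℝ (Fin N)} {l m : ℝ} (hlm : l ≤ m)
    (hl : reflectH l ω '' {x ∈ K | l ≤ ⟪x, ω⟫} ⊆ K) :
    reflectH m ω '' {x ∈ K | m ≤ ⟪x, ω⟫} ⊆ K := by
  rintro _ ⟨y, ⟨hy, hmy⟩, rfl⟩
  rcases hmy.eq_or_lt with h | h
  · simpa [reflectH, h] using hy
  · have hly : 0 < ⟪y, ω⟫ - l := by linarith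
    have hT : reflectH l ω y ∈ K := hl ⟨y, ⟨hy, by linarith⟩, rfl⟩
    have hmem := hK.add_smul_sub_mem hy hT
      (t := (⟪y, ω⟫ - m) / (⟪y, ω⟫ - l))
      ⟨div_nonneg (by linarith) hly.le, (div_le_one hly).2 (by linarith)⟩
    convert hmem using 1
    rw [reflectH, reflectH, add_sub_cancel_left, smul_smul]
    congr 2
    field_simp
    ring

/-- Reflecting the center of a ball towards the folded side does not decrease the volume of
its intersection with the set. -/
lemma volume_inter_closedBall_le_reflectH {N : ℕ} {K : Set (EuclideanSpace ℝ (Fin N))}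
    (hK : MeasurableSet K) {ω : EuclideanSpace ℝ (Fin N)} (hω : ‖ω‖ = 1) {l : ℝ}
    (hl : reflectH l ω '' {x ∈ K | l ≤ ⟪x, ω⟫} ⊆ K) (r : ℝ) {x : EuclideanSpace ℝ (Fin N)}
    (hx : l ≤ ⟪x, ω⟫) :
    volume (K ∩ closedBall x r) ≤ volume (K ∩ closedBall (reflectH l ω x) r) := by
  set x' := reflectH l ω x with hx'
  rw [← measure_inter_add_sdiff (K ∩ closedBall x r) (measurableSet_closedBall (x := x') (ε := r)),
    ← measure_inter_add_sdiff (K ∩ closedBall x' r) (measurableSet_closedBall (x := x) (ε := r)),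
    inter_right_comm]
  gcongr 1
  have hm : MeasurableSet ((K ∩ closedBall x' r) \ closedBall x r) :=
    (hK.inter measurableSet_closedBall).diff measurableSet_closedBall
  rw [← (measurePreserving_reflectH (l := l) hω).measure_preimage hm.nullMeasurableSet]
  refine measure_mono ?_
  rintro y ⟨⟨hyK, hyx⟩, hyx'⟩
  rw [mem_closedBall] at hyx
  rw [mem_closedBall, not_le] at hyx'
  have h1 : dist (reflectH l ω y) x' = dist y x := dist_reflectH_reflectH hω y x
  have h2 : dist (reflectH l ω y) x = dist y x' := by
    rw [← dist_reflectH_reflectH (l := l) hω y x', hx', reflectH_reflectH hω]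
  refine ⟨⟨hl ⟨y, ⟨hyK, ?_⟩, rfl⟩, ?_⟩, ?_⟩
  · by_contra! hy
    have h3 := dist_reflectH_sq (l := l) hω y x
    rw [h2] at h3
    have h4 : dist y x ^ 2 < dist y x' ^ 2 := by gcongr; exact hyx.trans_lt hyx'
    nlinarith [mul_nonneg (sub_nonneg.2 hy.le) (sub_nonneg.2 hx)]
  · rw [mem_closedBall, h1]; exact hyx
  · rw [mem_closedBall, h2, not_le]; exact hyx'

/-- Volume of the intersection of a compact set with a ball depends continuously on the center. -/
lemma continuous_volume_inter_closedBall {N : ℕ} {K : Set (EuclideanSpace ℝ (Fin N))}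
    (hK : IsCompact K) {r : ℝ} (hr : r ≠ 0) :
    Continuous fun x : EuclideanSpace ℝ (Fin N) => volume.real (K ∩ closedBall x r) := by
  have hf : (fun x : EuclideanSpace ℝ (Fin N) => volume.real (K ∩ closedBall x r)) =
      fun x => ∫ y in K, (closedBall x r).indicator (fun _ => (1 : ℝ)) y := by
    ext x
    rw [integral_indicator measurableSet_closedBall, setIntegral_const, smul_eq_mul, mul_one,
      measureReal_restrict_apply measurableSet_closedBall, inter_comm]
  rw [hf, continuous_iff_continuousAt]
  intro x
  refine continuousAt_of_dominated (bound := fun _ => (1 : ℝ)) ?_ ?_ ?_ ?_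
  · exact .of_forall fun z =>
      (measurable_const.indicator measurableSet_closedBall).aestronglyMeasurable
  · exact .of_forall fun z => .of_forall fun y =>
      (norm_indicator_le_norm_self _ _).trans (by simp)
  · exact integrableOn_const hK.measure_ne_top
  · have h0 : volume (sphere x r) = 0 := Measure.addHaar_sphere_of_ne_zero _ x hr
    filter_upwards [ae_restrict_of_ae (measure_eq_zero_iff_ae_notMem.1 h0)] with y hy
    have hd : Continuous fun z => dist y z := by fun_prop
    rw [mem_sphere] at hy
    rcases lt_or_gt_of_ne hy with h | h
    · refine (continuousAt_const (y := (1 : ℝ))).congr ?_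
      filter_upwards [hd.continuousAt.eventually_lt_const h] with z hz
      rw [indicator_of_mem (mem_closedBall.2 hz.le)]
    · refine (continuousAt_const (y := (0 : ℝ))).congr ?_
      filter_upwards [hd.continuousAt.eventually_const_lt h] with z hz
      rw [indicator_of_notMem (by rw [mem_closedBall]; exact not_le.2 hz)]

/-- The volume of the intersection with a ball of fixed radius is maximized at some center lying
in every half-space given by an admissible folding level. -/
lemma exists_maximal_center {N : ℕ} {K : Set (EuclideanSpace ℝ (Fin N))}
    (hKcpt : IsCompact K) (hKconv : Convex ℝ K) (hKne : K.Nonempty) {r : ℝ} (hr : 0 < r) :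
    ∃ x₀ : EuclideanSpace ℝ (Fin N),
      (∀ x, volume.real (K ∩ closedBall x r) ≤ volume.real (K ∩ closedBall x₀ r)) ∧
      ∀ (ω : EuclideanSpace ℝ (Fin N)) (l : ℝ), ‖ω‖ = 1 →
        reflectH l ω '' {x ∈ K | l ≤ ⟪x, ω⟫} ⊆ K → ⟪x₀, ω⟫ ≤ l := by
  set f : EuclideanSpace ℝ (Fin N) → ℝ := fun x => volume.real (K ∩ closedBall x r) with hf
  have hfc : Continuous f := continuous_volume_inter_closedBall hKcpt hr.ne'
  obtain ⟨k, hk⟩ := hKne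
  obtain ⟨x₁, hx₁⟩ : ∃ x₁, ∀ x, f x ≤ f x₁ := by
    refine hfc.exists_forall_ge' k ?_
    filter_upwards [(hKcpt.cthickening (r := r)).compl_mem_cocompact] with x hx
    have : K ∩ closedBall x r = ∅ := by
      ext y
      simp only [mem_inter_iff, mem_empty_iff_false, iff_false, not_and]
      intro hy hyx
      exact hx (mem_cthickening_of_dist_le x y r K hy (by rwa [dist_comm]))
    simp [hf, this, measureReal_nonneg]
  set Φ : EuclideanSpace ℝ (Fin N) → ℝ := fun x => sSup (dist x '' K) with hΦ
  have hΦc : Continuous Φ := hKcpt.continuous_sSup (f := fun x y => dist x y) continuous_dist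
  have hbdd : ∀ x, BddAbove (dist x '' K) := fun x =>
    (hKcpt.image (continuous_const.dist continuous_id)).bddAbove
  have hle : ∀ x, ∀ y ∈ K, dist x y ≤ Φ x := fun x y hy => le_csSup (hbdd x) ⟨y, hy, rfl⟩
  have hclosed : IsClosed {x | f x₁ ≤ f x} := isClosed_le continuous_const hfc
  obtain ⟨x₀, hx₀, hmin⟩ : ∃ x₀ ∈ {x | f x₁ ≤ f x}, IsMinOn Φ {x | f x₁ ≤ f x} x₀ := by
    refine hΦc.continuousOn.exists_isMinOn' hclosed (x₀ := x₁) (le_refl (f x₁)) ?_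
    refine Filter.Eventually.filter_mono inf_le_left ?_
    have ht : Filter.Tendsto (fun x => dist x k) (Filter.cocompact _) Filter.atTop :=
      tendsto_dist_right_cocompact_atTop k
    filter_upwards [ht.eventually_ge_atTop (Φ x₁)] with x hx
    exact hx.trans (hle x k hk)
  refine ⟨x₀, fun x => (hx₁ x).trans hx₀, fun ω l hω hl => ?_⟩
  by_contra! hlt
  set a := ⟪x₀, ω⟫ with ha
  set p := reflectH ((a + l) / 2) ω x₀ with hp
  have hp_mem : p ∈ {x | f x₁ ≤ f x} := by
    refine le_trans (b := f x₀) hx₀ ?_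
    refine ENNReal.toReal_mono ((measure_mono inter_subset_left).trans_lt
      hKcpt.measure_lt_top).ne ?_
    exact volume_inter_closedBall_le_reflectH hKcpt.measurableSet hω
      (image_reflectH_subset_of_le hKconv (by linarith) hl) r (by linarith)
  have hmin_p : Φ x₀ ≤ Φ p := hmin hp_mem
  obtain ⟨y, hy, hyp, -⟩ := hKcpt.exists_sSup_image_eq_and_ge ⟨k, hk⟩
    (f := dist p) (continuous_const.dist continuous_id).continuousOn
  have hyp : Φ p = dist p y := hyp
  have h1 := dist_reflectH_sq (l := (a + l) / 2) hω x₀ y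
  rw [← hp, ← ha] at h1
  have key : ∃ z ∈ K, dist p y ^ 2 + (a - l) ^ 2 ≤ dist x₀ z ^ 2 := by
    rcases le_total ⟪y, ω⟫ l with h | h
    · refine ⟨y, hy, ?_⟩
      nlinarith [mul_nonneg (sub_nonneg.2 h) (sub_nonneg.2 hlt.le)]
    · refine ⟨reflectH l ω y, hl ⟨y, ⟨hy, h⟩, rfl⟩, ?_⟩
      have h2 := dist_reflectH_sq (l := l) hω y x₀
      rw [dist_comm, dist_comm y, ← ha] at h2
      nlinarith [mul_nonneg (sub_nonneg.2 h) (sub_nonneg.2 hlt.le)]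
  obtain ⟨z, hz, hzle⟩ := key
  have h2 : dist x₀ z ≤ dist p y := (hle x₀ z hz).trans (hmin_p.trans hyp.le)
  have h3 : dist x₀ z ^ 2 ≤ dist p y ^ 2 := by gcongr
  nlinarith [sq_pos_of_pos (sub_pos.2 hlt)]

/-- The Fraenkel asymmetry of a convex body is attained by at least one ball centered at
a point of the heart: there is `x₀ ∈ ♥(K)` minimizing `x ↦ |K Δ B(x, r*)|`, where `r*`
is the radius with `|B(·, r*)| = |K|`. -/
theorem statement18 {N : ℕ} (K : Set (EuclideanSpace ℝ (Fin N)))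
    (hKcpt : IsCompact K) (hKconv : Convex ℝ K) (hKint : (interior K).Nonempty)
    (rs : ℝ) (hrs : 0 < rs)
    (hvol : volume (closedBall (0 : EuclideanSpace ℝ (Fin N)) rs) = volume K) :
    ∃ x₀ ∈ heart K, ∀ x : EuclideanSpace ℝ (Fin N),
      volume (symmDiff K (closedBall x₀ rs)) ≤ volume (symmDiff K (closedBall x rs)) := by
  obtain ⟨x₀, hmax, hhalf⟩ :=
    exists_maximal_center hKcpt hKconv (hKint.mono interior_subset) hrs
  have hempty : ∀ (ω : EuclideanSpace ℝ (Fin N)) (l : ℝ), (∀ y ∈ K, ⟪y, ω⟫ < l) →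
      reflectH l ω '' {x ∈ K | l ≤ ⟪x, ω⟫} ⊆ K := by
    rintro ω l h _ ⟨y, ⟨hy, hly⟩, rfl⟩
    exact absurd (h y hy) hly.not_gt
  refine ⟨x₀, ⟨?_, fun ω hω => ?_⟩, fun x => ?_⟩
  · by_contra hx₀
    obtain ⟨φ, u, hφ, hu⟩ := geometric_hahn_banach_closed_point hKconv hKcpt.isClosed hx₀
    set v := (InnerProductSpace.toDual ℝ (EuclideanSpace ℝ (Fin N))).symm φ with hv
    have hφv : ∀ y, φ y = ⟪y, v⟫ := fun y => by
      rw [real_inner_comm, hv, InnerProductSpace.toDual_symm_apply]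
    obtain ⟨k, hk⟩ := hKint.mono interior_subset
    have hv0 : v ≠ 0 := by
      intro h0
      have h1 := hφ k hk
      rw [hφv, h0, inner_zero_right] at h1 hu
      linarith
    have hpos : 0 < ‖v‖⁻¹ := inv_pos.2 (norm_pos_iff.2 hv0)
    have h := hhalf (‖v‖⁻¹ • v) (‖v‖⁻¹ * u) (norm_smul_inv_norm hv0) (hempty _ _ fun y hy => by
      rw [inner_smul_right, ← hφv]
      exact mul_lt_mul_of_pos_left (hφ y hy) hpos)
    rw [inner_smul_right, ← hφv] at h
    exact absurd (mul_lt_mul_of_pos_left hu hpos) h.not_gt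
  · refine le_csInf ?_ fun l hl => hhalf ω l hω hl
    obtain ⟨b, hb⟩ := (hKcpt.image (f := fun y => ⟪y, ω⟫)
      (continuous_id.inner continuous_const)).bddAbove
    exact ⟨b + 1, hempty ω _ fun y hy => (hb ⟨y, hy, rfl⟩).trans_lt (lt_add_one b)⟩
  · have hfin : ∀ z, volume (K ∩ closedBall z rs) ≠ ∞ := fun z =>
      ((measure_mono inter_subset_left).trans_lt hKcpt.measure_lt_top).ne
    have hle : volume (K ∩ closedBall x rs) ≤ volume (K ∩ closedBall x₀ rs) :=
      (ENNReal.toReal_le_toReal (hfin x) (hfin x₀)).1 (hmax x)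
    have hsymm : ∀ z, volume (symmDiff K (closedBall z rs)) =
        (volume K - volume (K ∩ closedBall z rs)) +
          (volume (closedBall (0 : EuclideanSpace ℝ (Fin N)) rs) -
            volume (K ∩ closedBall z rs)) := fun z => by
      rw [measure_symmDiff_eq hKcpt.measurableSet.nullMeasurableSet
        measurableSet_closedBall.nullMeasurableSet,
        ← Measure.addHaar_closedBall_center volume z rs, ← sdiff_self_inter,
        measure_sdiff inter_subset_left
          (hKcpt.measurableSet.inter measurableSet_closedBall).nullMeasurableSet (hfin z),
        ← sdiff_inter_self_eq_sdiff,
        measure_sdiff inter_subset_right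
          (hKcpt.measurableSet.inter measurableSet_closedBall).nullMeasurableSet (hfin z)]
    rw [hsymm, hsymm]
    gcongr
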